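/- Let p, q, r ∈ [1,∞] and λ > 0, and let U be the set of matrices Δ ∈ ℝ^{m×n} with ‖Δx‖_r ≤ λ‖x‖_q for all x ∈ ℝ^n. Then for every z ∈ ℝ^m and β ∈ ℝ^n, max_{Δ ∈ U} ‖z + Δβ‖_p ≤ ‖z‖_p + λ·δ_m(p,r)·‖β‖_q, with equality for all (z,β) when p ∈ {1,∞}; moreover for all (z,β) one has the lower bound ‖z‖_p + (λ/δ_m(r,p))·‖β‖_q ≤ max_{Δ ∈ U} ‖z + Δβ‖_p. -/

import Mathlib

open scoped ENNReal

noncomputable def lpNorm (p : ℝ≥0∞) {ι : Type*} [Fintype ι] (x : ι → ℝ) : ℝ :=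
  ‖(WithLp.equiv p (ι → ℝ)).symm x‖

noncomputable def frobNorm (p : ℝ≥0∞) {m n : ℕ} (A : Matrix (Fin m) (Fin n) ℝ) : ℝ :=
  lpNorm p (fun ij : Fin m × Fin n => A ij.1 ij.2)

noncomputable def discrep (m : ℕ) (a b : ℝ≥0∞) : ℝ :=
  sSup {t : ℝ | ∃ u : Fin m → ℝ, lpNorm b u = 1 ∧ t = lpNorm a u}

section LpNorm

variable {ι : Type*} [Fintype ι] {p : ℝ≥0∞}

theorem lpNorm_nonneg (hp : 1 ≤ p) (x : ι → ℝ) : 0 ≤ lpNorm p x :=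
  have := Fact.mk hp
  norm_nonneg _

theorem lpNorm_zero (hp : 1 ≤ p) : lpNorm p (0 : ι → ℝ) = 0 :=
  have := Fact.mk hp
  norm_zero (E := WithLp p (ι → ℝ))

theorem lpNorm_add_le (hp : 1 ≤ p) (x y : ι → ℝ) : lpNorm p (x + y) ≤ lpNorm p x + lpNorm p y :=
  have := Fact.mk hp
  norm_add_le (WithLp.toLp p x) (WithLp.toLp p y)

theorem lpNorm_smul (hp : 1 ≤ p) (c : ℝ) (x : ι → ℝ) : lpNorm p (c • x) = |c| * lpNorm p x :=
  have := Fact.mk hp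
  norm_smul c (WithLp.toLp p x)

theorem lpNorm_smul_of_nonneg (hp : 1 ≤ p) {c : ℝ} (hc : 0 ≤ c) (x : ι → ℝ) :
    lpNorm p (c • x) = c * lpNorm p x := by
  rw [lpNorm_smul hp, abs_of_nonneg hc]

theorem lpNorm_pos (hp : 1 ≤ p) {x : ι → ℝ} (hx : x ≠ 0) : 0 < lpNorm p x := by
  have := Fact.mk hp
  refine norm_pos_iff.2 fun h => hx ?_
  simpa using h

theorem abs_apply_le_lpNorm (hp : 1 ≤ p) (x : ι → ℝ) (i : ι) : |x i| ≤ lpNorm p x :=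
  have := Fact.mk hp
  PiLp.norm_apply_le (WithLp.toLp p x) i

theorem lpNorm_single [DecidableEq ι] (hp : 1 ≤ p) (i : ι) (c : ℝ) :
    lpNorm p (Pi.single i c) = |c| :=
  have := Fact.mk hp
  PiLp.norm_single p (fun _ : ι => ℝ) i c

theorem lpNorm_one_eq_sum (x : ι → ℝ) : lpNorm 1 x = ∑ i, |x i| := by
  simp [lpNorm, PiLp.norm_eq_sum (p := 1) (by simp)]

theorem lpNorm_top_eq_ciSup (x : ι → ℝ) : lpNorm ⊤ x = ⨆ i, |x i| := by
  simp [lpNorm, PiLp.norm_eq_ciSup]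

theorem exists_lpNorm_top_eq [Nonempty ι] (x : ι → ℝ) : ∃ i, lpNorm ⊤ x = |x i| := by
  obtain ⟨i, hi⟩ := exists_eq_ciSup_of_finite (f := fun i => |x i|)
  exact ⟨i, by rw [lpNorm_top_eq_ciSup, ← hi]⟩

theorem lpNorm_congr_abs (hp : 1 ≤ p) {x y : ι → ℝ} (h : ∀ i, |x i| = |y i|) :
    lpNorm p x = lpNorm p y := by
  by_cases hpt : p = ⊤
  · subst hpt
    simp [lpNorm_top_eq_ciSup, h]
  · have : 0 < p.toReal := ENNReal.toReal_pos (by positivity) hpt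
    simp [lpNorm, PiLp.norm_eq_sum this, h]

theorem exists_lpNorm_eq_one_and_eq_smul [Nonempty ι] (hp : 1 ≤ p) (z : ι → ℝ) :
    ∃ u, lpNorm p u = 1 ∧ z = lpNorm p z • u := by
  classical
  rcases eq_or_ne z 0 with rfl | hz
  · exact ⟨Pi.single (Classical.arbitrary ι) 1, by simp [lpNorm_single hp],
      by simp [lpNorm_zero hp]⟩
  · have h := lpNorm_pos hp hz
    refine ⟨(lpNorm p z)⁻¹ • z, ?_, ?_⟩
    · rw [lpNorm_smul_of_nonneg hp (by positivity), inv_mul_cancel₀ h.ne']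
    · rw [smul_inv_smul₀ h.ne']

theorem exists_norming_functional (hp : 1 ≤ p) (x : ι → ℝ) :
    ∃ g : (ι → ℝ) →ₗ[ℝ] ℝ, (∀ y, |g y| ≤ lpNorm p y) ∧ g x = lpNorm p x := by
  have := Fact.mk hp
  obtain ⟨g, hg, hgx⟩ := exists_dual_vector'' ℝ (WithLp.toLp p x)
  refine ⟨g.toLinearMap ∘ₗ (WithLp.linearEquiv p ℝ (ι → ℝ)).symm.toLinearMap, fun y => ?_, hgx⟩
  exact (g.le_of_opNorm_le hg (WithLp.toLp p y)).trans_eq (one_mul _)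

theorem exists_lpNorm_le_mul_lpNorm {q : ℝ≥0∞} (hp : 1 ≤ p) (hq : 1 ≤ q) :
    ∃ C, ∀ x : ι → ℝ, lpNorm p x ≤ C * lpNorm q x := by
  have := Fact.mk hp
  have := Fact.mk hq
  let T : WithLp q (ι → ℝ) →L[ℝ] WithLp p (ι → ℝ) := LinearMap.toContinuousLinearMap
    ((WithLp.linearEquiv q ℝ (ι → ℝ)).trans (WithLp.linearEquiv p ℝ (ι → ℝ)).symm).toLinearMap
  exact ⟨‖T‖, fun x => T.le_opNorm (WithLp.toLp q x)⟩

end LpNorm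

section Discrep

variable {m : ℕ} {a b : ℝ≥0∞}

theorem lpNorm_le_discrep (ha : 1 ≤ a) (hb : 1 ≤ b) {u : Fin m → ℝ} (hu : lpNorm b u = 1) :
    lpNorm a u ≤ discrep m a b := by
  obtain ⟨C, hC⟩ := exists_lpNorm_le_mul_lpNorm (ι := Fin m) ha hb
  refine le_csSup ⟨C, ?_⟩ ⟨u, hu, rfl⟩
  rintro _ ⟨v, hv, rfl⟩
  simpa [hv] using hC v

theorem discrep_nonneg (ha : 1 ≤ a) : 0 ≤ discrep m a b := by
  refine Real.sSup_nonneg ?_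
  rintro _ ⟨v, -, rfl⟩
  exact lpNorm_nonneg ha v

theorem lpNorm_le_discrep_mul (ha : 1 ≤ a) (hb : 1 ≤ b) (x : Fin m → ℝ) :
    lpNorm a x ≤ discrep m a b * lpNorm b x := by
  rcases isEmpty_or_nonempty (Fin m) with h | h
  · simp [Subsingleton.elim x 0, lpNorm_zero ha, lpNorm_zero hb]
  · obtain ⟨u, hu, hx⟩ := exists_lpNorm_eq_one_and_eq_smul hb x
    have hx' := lpNorm_nonneg hb x
    calc lpNorm a x = lpNorm b x * lpNorm a u := by
          rw [← lpNorm_smul_of_nonneg ha hx', ← hx]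
      _ ≤ lpNorm b x * discrep m a b := by gcongr; exact lpNorm_le_discrep ha hb hu
      _ = _ := mul_comm _ _

theorem discrep_of_isEmpty [IsEmpty (Fin m)] (hb : 1 ≤ b) : discrep m a b = 0 := by
  have h : {t : ℝ | ∃ u : Fin m → ℝ, lpNorm b u = 1 ∧ t = lpNorm a u} = ∅ := by
    refine Set.eq_empty_of_forall_notMem ?_
    rintro _ ⟨u, hu, -⟩
    simp [Subsingleton.elim u 0, lpNorm_zero hb] at hu
  rw [discrep, h, Real.sSup_empty]

theorem discrep_pos [Nonempty (Fin m)] (ha : 1 ≤ a) (hb : 1 ≤ b) : 0 < discrep m a b := by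
  obtain ⟨u, hu, -⟩ := exists_lpNorm_eq_one_and_eq_smul hb (0 : Fin m → ℝ)
  refine (lpNorm_pos ha ?_).trans_le (lpNorm_le_discrep ha hb hu)
  rintro rfl
  simp [lpNorm_zero hb] at hu

end Discrep

/-- For `p ∈ {1, ∞}` and `u` in the `ℓ_r` unit sphere, some `w` in the `ℓ_r` unit ball increases
the `ℓ_p` norm of `z` at rate at least `lpNorm p u`. -/
theorem exists_aligned {ι : Type*} [Fintype ι] {p r : ℝ≥0∞} (h : p = 1 ∨ p = ⊤) (hr : 1 ≤ r)
    (z u : ι → ℝ) (hu : lpNorm r u = 1) :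
    ∃ w, lpNorm r w ≤ 1 ∧ ∀ c, 0 ≤ c → lpNorm p z + c * lpNorm p u ≤ lpNorm p (z + c • w) := by
  classical
  let s : ι → ℝ := fun i => if 0 ≤ z i then 1 else -1
  have key : ∀ i (t : ℝ), 0 ≤ t → |z i + s i * t| = |z i| + t := by
    intro i t ht
    by_cases hz : 0 ≤ z i
    · simp only [s, if_pos hz, abs_of_nonneg hz, one_mul]
      exact abs_of_nonneg (by positivity)
    · have hz' := not_le.1 hz
      simp only [s, if_neg hz, abs_of_neg hz']
      rw [abs_of_neg (by linarith)]
      ring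
  have hs : ∀ i, |s i| = 1 := by
    intro i
    by_cases hz : 0 ≤ z i <;> simp [s, hz]
  rcases h with rfl | rfl
  · refine ⟨fun i => s i * |u i|, ?_, fun c hc => ?_⟩
    · rw [lpNorm_congr_abs hr (y := u) (by simp [abs_mul, hs]), hu]
    · simp only [lpNorm_one_eq_sum, Finset.mul_sum, ← Finset.sum_add_distrib]
      refine Finset.sum_le_sum fun i _ => ?_
      have := key i (c * |u i|) (by positivity)
      simp only [Pi.add_apply, Pi.smul_apply, smul_eq_mul]
      rw [← this, mul_left_comm]
  · rcases isEmpty_or_nonempty ι with hι | hι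
    · simp [Subsingleton.elim u 0, lpNorm_zero hr] at hu
    obtain ⟨i, hi⟩ := exists_lpNorm_top_eq z
    obtain ⟨j, hj⟩ := exists_lpNorm_top_eq u
    refine ⟨Pi.single i (s i * |u j|), ?_, fun c hc => ?_⟩
    · rw [lpNorm_single hr, abs_mul, hs, one_mul, abs_abs, ← hu]
      exact abs_apply_le_lpNorm hr u j
    · refine le_trans (le_of_eq ?_) (abs_apply_le_lpNorm le_top _ i)
      have := key i (c * |u j|) (by positivity)
      simp only [Pi.add_apply, Pi.smul_apply, smul_eq_mul, Pi.single_eq_same]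
      rw [hi, hj, ← this, mul_left_comm]

/-- A rank-one member of the uncertainty set, obtained from a norming functional of `β`. -/
theorem exists_matrix_mulVec_eq {m n : ℕ} {q r : ℝ≥0∞} (hq : 1 ≤ q) (hr : 1 ≤ r) {lam : ℝ}
    (β : Fin n → ℝ) {w : Fin m → ℝ} (hw : lpNorm r w ≤ lam) :
    ∃ Δ : Matrix (Fin m) (Fin n) ℝ, (∀ x, lpNorm r (Δ.mulVec x) ≤ lam * lpNorm q x) ∧
      Δ.mulVec β = lpNorm q β • w := by
  obtain ⟨g, hg, hgβ⟩ := exists_norming_functional hq β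
  have h : ∀ x, (LinearMap.toMatrix' (g.smulRight w)).mulVec x = g x • w := fun x => by
    rw [LinearMap.toMatrix'_mulVec, LinearMap.smulRight_apply]
  refine ⟨LinearMap.toMatrix' (g.smulRight w), fun x => ?_, by rw [h, hgβ]⟩
  rw [h, lpNorm_smul hr, mul_comm]
  exact mul_le_mul hw (hg x) (abs_nonneg _) ((lpNorm_nonneg hr w).trans hw)

/-- Upper and lower regularization bounds for ℓ_p regression under the induced (q,r)
uncertainty set, with equality in the upper bound when p ∈ {1,∞}. -/
theorem stmt16 {m n : ℕ} (p q r : ℝ≥0∞) (hp : 1 ≤ p) (hq : 1 ≤ q) (hr : 1 ≤ r)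
    (lam : ℝ) (hlam : 0 < lam) :
    (∀ (z : Fin m → ℝ) (β : Fin n → ℝ),
      sSup {t : ℝ | ∃ Δ : Matrix (Fin m) (Fin n) ℝ,
          (∀ x : Fin n → ℝ, lpNorm r (Δ.mulVec x) ≤ lam * lpNorm q x) ∧
          t = lpNorm p (z + Δ.mulVec β)} ≤
        lpNorm p z + lam * discrep m p r * lpNorm q β) ∧
    ((p = 1 ∨ p = ⊤) → ∀ (z : Fin m → ℝ) (β : Fin n → ℝ),
      sSup {t : ℝ | ∃ Δ : Matrix (Fin m) (Fin n) ℝ,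
          (∀ x : Fin n → ℝ, lpNorm r (Δ.mulVec x) ≤ lam * lpNorm q x) ∧
          t = lpNorm p (z + Δ.mulVec β)} =
        lpNorm p z + lam * discrep m p r * lpNorm q β) ∧
    (∀ (z : Fin m → ℝ) (β : Fin n → ℝ),
      lpNorm p z + lam / discrep m r p * lpNorm q β ≤
        sSup {t : ℝ | ∃ Δ : Matrix (Fin m) (Fin n) ℝ,
          (∀ x : Fin n → ℝ, lpNorm r (Δ.mulVec x) ≤ lam * lpNorm q x) ∧
          t = lpNorm p (z + Δ.mulVec β)}) := by
  have upper : ∀ (z : Fin m → ℝ) (β : Fin n → ℝ), ∀ t ∈ {t : ℝ |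
      ∃ Δ : Matrix (Fin m) (Fin n) ℝ,
        (∀ x : Fin n → ℝ, lpNorm r (Δ.mulVec x) ≤ lam * lpNorm q x) ∧
        t = lpNorm p (z + Δ.mulVec β)},
      t ≤ lpNorm p z + lam * discrep m p r * lpNorm q β := by
    rintro z β _ ⟨Δ, hΔ, rfl⟩
    have hd := discrep_nonneg (m := m) (b := r) hp
    calc lpNorm p (z + Δ.mulVec β) ≤ lpNorm p z + lpNorm p (Δ.mulVec β) := lpNorm_add_le hp _ _
      _ ≤ lpNorm p z + discrep m p r * lpNorm r (Δ.mulVec β) := by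
        gcongr
        exact lpNorm_le_discrep_mul hp hr _
      _ ≤ lpNorm p z + discrep m p r * (lam * lpNorm q β) := by
        gcongr
        exact hΔ β
      _ = _ := by ring
  have lower : ∀ (z : Fin m → ℝ) (β : Fin n → ℝ) (w : Fin m → ℝ), lpNorm r w ≤ lam →
      lpNorm p (z + lpNorm q β • w) ≤ sSup {t : ℝ | ∃ Δ : Matrix (Fin m) (Fin n) ℝ,
        (∀ x : Fin n → ℝ, lpNorm r (Δ.mulVec x) ≤ lam * lpNorm q x) ∧
        t = lpNorm p (z + Δ.mulVec β)} := by
    intro z β w hw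
    obtain ⟨Δ, hΔ, hΔβ⟩ := exists_matrix_mulVec_eq hq hr β hw
    exact le_csSup ⟨_, upper z β⟩ ⟨Δ, hΔ, by rw [hΔβ]⟩
  have lower_zero := fun z β => lower z β 0 ((lpNorm_zero hr).trans_le hlam.le)
  simp only [smul_zero, add_zero] at lower_zero
  have le_upper : ∀ (z : Fin m → ℝ) (β : Fin n → ℝ),
      sSup {t : ℝ | ∃ Δ : Matrix (Fin m) (Fin n) ℝ,
        (∀ x : Fin n → ℝ, lpNorm r (Δ.mulVec x) ≤ lam * lpNorm q x) ∧
        t = lpNorm p (z + Δ.mulVec β)} ≤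
        lpNorm p z + lam * discrep m p r * lpNorm q β := by
    refine fun z β => csSup_le ⟨_, 0, fun x => ?_, rfl⟩ (upper z β)
    rw [Matrix.zero_mulVec, lpNorm_zero hr]
    exact mul_nonneg hlam.le (lpNorm_nonneg hq x)
  refine ⟨le_upper, fun hp' z β => (le_upper z β).antisymm ?_, fun z β => ?_⟩
  · rcases isEmpty_or_nonempty (Fin m) with hm | hm
    · simpa [discrep_of_isEmpty hr] using lower_zero z β
    rcases (lpNorm_nonneg hq β).eq_or_lt with hβ | hβ
    · simpa [← hβ] using lower_zero z β
    obtain ⟨u₀, hu₀, -⟩ := exists_lpNorm_eq_one_and_eq_smul hr (0 : Fin m → ℝ)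
    rw [← le_sub_iff_add_le', mul_right_comm, ← le_div_iff₀' (by positivity)]
    refine csSup_le ⟨_, u₀, hu₀, rfl⟩ ?_
    rintro _ ⟨u, hu, rfl⟩
    rw [le_div_iff₀' (by positivity), le_sub_iff_add_le']
    obtain ⟨w, hw, hzw⟩ := exists_aligned hp' hr z u hu
    refine (hzw _ (by positivity)).trans ?_
    rw [mul_comm lam, mul_smul]
    refine lower z β (lam • w) ?_
    rw [lpNorm_smul_of_nonneg hr hlam.le]
    exact mul_le_of_le_one_right hlam.le hw
  · rcases isEmpty_or_nonempty (Fin m) with hm | hm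
    · simpa [discrep_of_isEmpty hp] using lower_zero z β
    obtain ⟨u, hu, hz⟩ := exists_lpNorm_eq_one_and_eq_smul hp z
    have hd := discrep_pos (m := m) hr hp
    have hz0 := lpNorm_nonneg hp z
    have hβ0 := lpNorm_nonneg hq β
    have hw : lpNorm r ((lam / discrep m r p) • u) ≤ lam := by
      rw [lpNorm_smul_of_nonneg hr (by positivity), div_mul_eq_mul_div, div_le_iff₀ hd]
      gcongr
      exact lpNorm_le_discrep hr hp hu
    refine le_of_eq_of_le ?_ (lower z β _ hw)
    conv_rhs => rw [hz, smul_smul, ← add_smul, lpNorm_smul_of_nonneg hp (by positivity), hu]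
    ring
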